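/- Let K ⊂ ℝ^d be compact and let (f_ε)_{ε∈(0,1)} be a net of smooth functions on ℝ^d with supp f_ε ⊆ K for all ε, which is {M_p}-moderate. Assume there exist (r̃_i) ∈ 𝕽 and a compact set K_1 ⊂ ℝ^d with K contained in the interior of K_1 such that for every smooth function φ : ℝ^d → ℂ with supp φ ⊆ K_1 and sup_{x∈ℝ^d, α∈ℕ^d} |∂^α φ(x)|/(M_{|α|}·Π_{i=1}^{|α|} r̃_i) < ∞, the net of complex numbers (∫_{ℝ^d} f_ε(x) φ(x) dx)_{ε∈(0,1)} satisfies: for every (k_i) ∈ 𝕽 there are C > 0 and ε_0 ∈ (0,1) with |∫ f_ε φ dx| ≤ C·e^{−N_{(k_i)}(1/ε)} for all ε < ε_0. Then (f_ε) is {M_p}-negligible. -/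

import Mathlib

open scoped BigOperators

/-- `log₊ x = max (log x) 0`. -/
noncomputable def logPlus (x : ℝ) : ℝ := max (Real.log x) 0

/-- The associated function `M(ρ) = sup_p log₊ (ρ^p / M_p)`. -/
noncomputable def assocM (Mp : ℕ → ℝ) (ρ : ℝ) : ℝ :=
  ⨆ p : ℕ, logPlus (ρ ^ p / Mp p)

/-- `N_{(r_i)}(ρ) = sup_p log₊ (ρ^p / (M_p · Π_{i=1}^p r_i))`
(the sequence `(r_i)_{i≥1}` is indexed here by `ℕ`, `r 0 = r_1`, etc.). -/
noncomputable def assocN (Mp : ℕ → ℝ) (r : ℕ → ℝ) (ρ : ℝ) : ℝ :=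
  ⨆ p : ℕ, logPlus (ρ ^ p / (Mp p * ∏ i ∈ Finset.range p, r i))

/-- `(r_i) ∈ 𝕽`: positive, monotonically increasing, tending to infinity. -/
def InRcal (r : ℕ → ℝ) : Prop :=
  (∀ i, 0 < r i) ∧ Monotone r ∧ Filter.Tendsto r Filter.atTop Filter.atTop

/-- Condition (M.1): logarithmic convexity. -/
def CondM1 (Mp : ℕ → ℝ) : Prop :=
  ∀ p : ℕ, (Mp (p + 1)) ^ 2 ≤ Mp p * Mp (p + 2)

/-- Condition (M.2) with constants `c0, H`. -/
def CondM2 (Mp : ℕ → ℝ) (c0 H : ℝ) : Prop :=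
  ∀ p q : ℕ, Mp (p + q) ≤ c0 * H ^ (p + q) * Mp p * Mp q

/-- Condition (M.2). -/
def CondM2' (Mp : ℕ → ℝ) : Prop :=
  ∃ c0 H : ℝ, 1 ≤ c0 ∧ 1 ≤ H ∧ CondM2 Mp c0 H

/-- Condition (M.3): `Σ_{j=p+1}^∞ M_{j-1}/M_j ≤ c0 · p · M_p / M_{p+1}`. -/
def CondM3 (Mp : ℕ → ℝ) : Prop :=
  ∃ c0 : ℝ, 1 ≤ c0 ∧ ∀ p : ℕ, 1 ≤ p →
    ∑' n : ℕ, Mp (p + n) / Mp (p + n + 1) ≤ c0 * p * Mp p / Mp (p + 1)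

/-- The partial derivative `∂_j` of a function on `ℝ^d`. -/
noncomputable def pderiv1 {d : ℕ} (j : Fin d) (f : EuclideanSpace ℝ (Fin d) → ℂ) :
    EuclideanSpace ℝ (Fin d) → ℂ :=
  fun x => fderiv ℝ f x (EuclideanSpace.single j 1)

/-- The multi-index partial derivative `∂^α = ∂_1^{α_1} ⋯ ∂_d^{α_d}`. -/
noncomputable def mderiv {d : ℕ} (α : Fin d → ℕ) (f : EuclideanSpace ℝ (Fin d) → ℂ) :
    EuclideanSpace ℝ (Fin d) → ℂ :=
  (List.finRange d).foldr (fun j g => (pderiv1 j)^[α j] g) f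

/-- An `{M_p}`-moderate net of smooth functions on `ℝ^d`. -/
def ModerateR {d : ℕ} (Mp : ℕ → ℝ) (f : ℝ → EuclideanSpace ℝ (Fin d) → ℂ) : Prop :=
  ∀ K' : Set (EuclideanSpace ℝ (Fin d)), IsCompact K' → ∀ h : ℕ → ℝ, InRcal h →
    ∃ k : ℕ → ℝ, InRcal k ∧ ∃ C : ℝ, 0 < C ∧ ∃ ε₀ ∈ Set.Ioo (0 : ℝ) 1,
      ∀ ε : ℝ, 0 < ε → ε < ε₀ → ∀ x ∈ K', ∀ α : Fin d → ℕ,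
        ‖mderiv α (f ε) x‖ / (Mp (∑ j, α j) * ∏ i ∈ Finset.range (∑ j, α j), h i) ≤
          C * Real.exp (assocN Mp k (1 / ε))

/-- An `{M_p}`-negligible net of smooth functions on `ℝ^d`. -/
def NegligibleR {d : ℕ} (Mp : ℕ → ℝ) (f : ℝ → EuclideanSpace ℝ (Fin d) → ℂ) : Prop :=
  ∀ K' : Set (EuclideanSpace ℝ (Fin d)), IsCompact K' → ∀ h : ℕ → ℝ, InRcal h →
    ∀ k : ℕ → ℝ, InRcal k →
      ∃ C : ℝ, 0 < C ∧ ∃ ε₀ ∈ Set.Ioo (0 : ℝ) 1,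
        ∀ ε : ℝ, 0 < ε → ε < ε₀ → ∀ x ∈ K', ∀ α : Fin d → ℕ,
          ‖mderiv α (f ε) x‖ / (Mp (∑ j, α j) * ∏ i ∈ Finset.range (∑ j, α j), h i) ≤
            C * Real.exp (-assocN Mp k (1 / ε))

theorem InRcal.prod_pos {r : ℕ → ℝ} (hr : InRcal r) (p : ℕ) :
    0 < ∏ i ∈ Finset.range p, r i := Finset.prod_pos fun i _ => hr.1 i

theorem InRcal.min {r s : ℕ → ℝ} (hr : InRcal r) (hs : InRcal s) :
    InRcal fun i => min (r i) (s i) := by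
  refine ⟨fun i => lt_min (hr.1 i) (hs.1 i),
    fun i j hij => min_le_min (hr.2.1 hij) (hs.2.1 hij), ?_⟩
  rw [Filter.tendsto_atTop]
  intro b
  filter_upwards [Filter.tendsto_atTop.1 hr.2.2 b, Filter.tendsto_atTop.1 hs.2.2 b] with i h1 h2
  exact le_min h1 h2

theorem InRcal.halve {r : ℕ → ℝ} (hr : InRcal r) {H : ℝ} (hH : 0 < H) :
    InRcal fun i => r (i / 2) / H := by
  refine ⟨fun i => div_pos (hr.1 _) hH, fun i j hij => ?_, ?_⟩
  · exact div_le_div_of_nonneg_right (hr.2.1 (Nat.div_le_div_right hij)) hH.le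
  · exact (hr.2.2.comp (Nat.tendsto_div_const_atTop two_ne_zero)).atTop_div_const hH

theorem prod_range_halve (r : ℕ → ℝ) (H : ℝ) (p : ℕ) :
    ∏ i ∈ Finset.range (2 * p), r (i / 2) / H =
      (∏ i ∈ Finset.range p, r i) ^ 2 / H ^ (2 * p) := by
  induction p with
  | zero => simp
  | succ p ih =>
    rw [show 2 * (p + 1) = 2 * p + 1 + 1 by ring, Finset.prod_range_succ, Finset.prod_range_succ,
      ih, Finset.prod_range_succ, show (2 * p + 1) / 2 = p by omega,
      show 2 * p / 2 = p by omega]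
    ring

theorem prod_range_succ_halve_le {r : ℕ → ℝ} (hr : InRcal r) {H : ℝ} (hH : 0 < H) (p : ℕ) :
    ∏ i ∈ Finset.range (p + 1), r (i / 2) / H ≤
      r 0 * (∏ i ∈ Finset.range p, r i) / H ^ (p + 1) := by
  rw [Finset.prod_div_distrib, Finset.prod_const, Finset.card_range, Finset.prod_range_succ']
  refine div_le_div_of_nonneg_right ?_ (pow_pos hH _).le
  rw [mul_comm, Nat.zero_div]
  refine mul_le_mul_of_nonneg_left (Finset.prod_le_prod (fun i _ => (hr.1 _).le) fun i _ => ?_)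
    (hr.1 0).le
  exact hr.2.1 (by omega)

theorem logPlus_le_iff {x a : ℝ} (hx : 0 < x) (ha : 0 ≤ a) :
    logPlus x ≤ a ↔ x ≤ Real.exp a := by
  rw [logPlus, max_le_iff, Real.log_le_iff_le_exp hx]
  exact and_iff_left ha

theorem one_pow_mul_le_of_condM1 {Mp : ℕ → ℝ} (hMpos : ∀ p, 0 < Mp p) (hM0 : Mp 0 = 1)
    (hM1 : CondM1 Mp) (p : ℕ) : Mp 1 ^ p ≤ Mp p := by
  have hstep : ∀ p, Mp 1 * Mp p ≤ Mp (p + 1) := by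
    intro p
    induction p with
    | zero => simp [hM0]
    | succ p ih =>
      have h1 := hM1 p
      have h2 := hMpos p
      have h3 := hMpos (p + 1)
      refine le_of_mul_le_mul_left ?_ h2
      nlinarith
  induction p with
  | zero => simp [hM0]
  | succ p ih =>
    calc Mp 1 ^ (p + 1) = Mp 1 * Mp 1 ^ p := by ring
      _ ≤ Mp 1 * Mp p := mul_le_mul_of_nonneg_left ih (hMpos 1).le
      _ ≤ _ := hstep p

theorem exists_pow_le_mul_prod {r : ℕ → ℝ} (hr : InRcal r) {a : ℝ} (ha : 0 < a) :
    ∃ B, 0 < B ∧ ∀ p : ℕ, a ^ p ≤ B * ∏ i ∈ Finset.range p, r i := by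
  obtain ⟨n, hn⟩ := (Filter.tendsto_atTop.1 hr.2.2 a).exists_forall_of_atTop
  have hb : ∀ p, ∃ B, 0 < B ∧ a ^ p ≤ B * ∏ i ∈ Finset.range p, r i := fun p =>
    ⟨a ^ p / ∏ i ∈ Finset.range p, r i, div_pos (pow_pos ha p) (hr.prod_pos p),
      by rw [div_mul_cancel₀ _ (hr.prod_pos p).ne']⟩
  have hfin : ∀ m, ∃ B, 0 < B ∧ ∀ p ≤ m, a ^ p ≤ B * ∏ i ∈ Finset.range p, r i := by
    intro m
    induction m with
    | zero =>
      obtain ⟨B, hB, h⟩ := hb 0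
      exact ⟨B, hB, fun p hp => by rwa [Nat.le_zero.1 hp]⟩
    | succ m ih =>
      obtain ⟨B, hB, h⟩ := ih
      obtain ⟨B', hB', h'⟩ := hb (m + 1)
      refine ⟨max B B', lt_max_of_lt_left hB, fun p hp => ?_⟩
      rcases Nat.le_succ_iff.1 hp with hp | rfl
      · exact (h p hp).trans
          (mul_le_mul_of_nonneg_right (le_max_left _ _) (hr.prod_pos p).le)
      · exact h'.trans
          (mul_le_mul_of_nonneg_right (le_max_right _ _) (hr.prod_pos _).le)
  obtain ⟨B, hB, h⟩ := hfin n
  refine ⟨B, hB, fun p => ?_⟩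
  rcases le_total p n with hp | hp
  · exact h p hp
  · induction p, hp using Nat.le_induction with
    | base => exact h n le_rfl
    | succ p hp ih =>
      rw [pow_succ, Finset.prod_range_succ, ← mul_assoc]
      exact mul_le_mul ih (hn p hp) ha.le (mul_pos hB (hr.prod_pos p)).le

section AssociatedFunction

variable {Mp : ℕ → ℝ} (hMpos : ∀ p, 0 < Mp p) (hM0 : Mp 0 = 1) (hM1 : CondM1 Mp)

include hMpos hM0 hM1

theorem bddAbove_logPlus {r : ℕ → ℝ} (hr : InRcal r) {ρ : ℝ} (hρ : 0 < ρ) :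
    BddAbove (Set.range fun p : ℕ =>
      logPlus (ρ ^ p / (Mp p * ∏ i ∈ Finset.range p, r i))) := by
  obtain ⟨B, hB, h⟩ := exists_pow_le_mul_prod hr (div_pos hρ (hMpos 1))
  refine ⟨logPlus B, ?_⟩
  rintro _ ⟨p, rfl⟩
  have hp := mul_pos (hMpos p) (hr.prod_pos p)
  refine max_le_max (Real.log_le_log (div_pos (pow_pos hρ p) hp) ?_) le_rfl
  rw [div_le_iff₀ hp]
  have h1 := h p
  rw [div_pow, div_le_iff₀ (pow_pos (hMpos 1) p)] at h1
  have h2 := mul_le_mul_of_nonneg_left (one_pow_mul_le_of_condM1 hMpos hM0 hM1 p)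
    (mul_pos hB (hr.prod_pos p)).le
  linarith

theorem pow_div_le_exp_assocN {r : ℕ → ℝ} (hr : InRcal r) {ρ : ℝ} (hρ : 0 < ρ) (p : ℕ) :
    ρ ^ p / (Mp p * ∏ i ∈ Finset.range p, r i) ≤ Real.exp (assocN Mp r ρ) := by
  have hp := mul_pos (hMpos p) (hr.prod_pos p)
  have h := le_ciSup (bddAbove_logPlus hMpos hM0 hM1 hr hρ) p
  exact (Real.log_le_iff_le_exp (div_pos (pow_pos hρ p) hp)).1 ((le_max_left _ _).trans h)

theorem assocN_anti {r s : ℕ → ℝ} (hr : InRcal r) (hs : InRcal s) (hrs : ∀ i, r i ≤ s i)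
    {ρ : ℝ} (hρ : 0 < ρ) : assocN Mp s ρ ≤ assocN Mp r ρ := by
  refine ciSup_mono (bddAbove_logPlus hMpos hM0 hM1 hr hρ) fun p => ?_
  refine max_le_max (Real.log_le_log (div_pos (pow_pos hρ p)
    (mul_pos (hMpos p) (hs.prod_pos p))) ?_) le_rfl
  exact div_le_div_of_nonneg_left (pow_pos hρ p).le (mul_pos (hMpos p) (hr.prod_pos p))
    (mul_le_mul_of_nonneg_left (Finset.prod_le_prod (fun i _ => (hr.1 i).le) fun i _ => hrs i)
      (hMpos p).le)

omit hMpos hM0 hM1 in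
theorem assocN_nonneg (r : ℕ → ℝ) (ρ : ℝ) : 0 ≤ assocN Mp r ρ :=
  Real.iSup_nonneg fun _ => le_max_right _ _

theorem two_mul_assocN_le {c₀ H : ℝ} (hc₀ : 1 ≤ c₀) (hH : 1 ≤ H) (hM2 : CondM2 Mp c₀ H)
    {r : ℕ → ℝ} (hr : InRcal r) {ρ : ℝ} (hρ : 0 < ρ) :
    2 * assocN Mp r ρ ≤ assocN Mp (fun i => r (i / 2) / H) ρ + Real.log c₀ := by
  have hH0 : 0 < H := by linarith
  have hc0 : 0 < c₀ := by linarith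
  have hk := hr.halve hH0
  set X := assocN Mp (fun i => r (i / 2) / H) ρ with hX
  have hX0 : 0 ≤ X := assocN_nonneg _ _
  have hl : 0 ≤ Real.log c₀ := Real.log_nonneg hc₀
  suffices assocN Mp r ρ ≤ (X + Real.log c₀) / 2 by linarith
  refine ciSup_le fun p => ?_
  have hR := hr.prod_pos p
  have hp := mul_pos (hMpos p) hR
  rw [logPlus_le_iff (div_pos (pow_pos hρ p) hp) (by positivity)]
  have h1 := pow_div_le_exp_assocN hMpos hM0 hM1 hk hρ (2 * p)
  rw [prod_range_halve, ← hX] at h1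
  have h2 := hM2 p p
  rw [← two_mul] at h2
  refine le_of_sq_le_sq ?_ (Real.exp_pos _).le
  have hexp : Real.exp ((X + Real.log c₀) / 2) ^ 2 = Real.exp X * c₀ := by
    rw [← Real.exp_nat_mul, ← Real.exp_log hc0, ← Real.exp_add, Real.exp_log hc0]
    congr 1
    push_cast
    ring
  rw [hexp, div_pow, div_le_iff₀ (by positivity)]
  have hM2p := hMpos (2 * p)
  rw [div_le_iff₀ (by positivity)] at h1
  calc (ρ ^ p) ^ 2 = ρ ^ (2 * p) := by ring
    _ ≤ _ := h1
    _ ≤ Real.exp X * (c₀ * H ^ (2 * p) * Mp p * Mp p *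
        ((∏ i ∈ Finset.range p, r i) ^ 2 / H ^ (2 * p))) := by gcongr
    _ = _ := by field_simp

theorem exists_nat_mul_assocN_le (hM2 : CondM2' Mp) {r : ℕ → ℝ} (hr : InRcal r) (n : ℕ) :
    ∃ k, InRcal k ∧ ∃ D, ∀ ρ, 0 < ρ → n * assocN Mp r ρ ≤ assocN Mp k ρ + D := by
  obtain ⟨c₀, H, hc₀, hH, hM2⟩ := hM2
  have key : ∀ m : ℕ, ∃ k, InRcal k ∧ ∃ D, ∀ ρ, 0 < ρ →
      2 ^ m * assocN Mp r ρ ≤ assocN Mp k ρ + D := by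
    intro m
    induction m with
    | zero => exact ⟨r, hr, 0, fun ρ _ => by simp⟩
    | succ m ih =>
      obtain ⟨k, hk, D, h⟩ := ih
      refine ⟨_, hk.halve (by linarith : 0 < H), Real.log c₀ + 2 * D, fun ρ hρ => ?_⟩
      have h1 := h ρ hρ
      have h2 := two_mul_assocN_le hMpos hM0 hM1 hc₀ hH hM2 hk hρ
      rw [pow_succ]
      linarith
  obtain ⟨k, hk, D, h⟩ := key n
  refine ⟨k, hk, D, fun ρ hρ => le_trans ?_ (h ρ hρ)⟩
  refine mul_le_mul_of_nonneg_right ?_ (assocN_nonneg _ _)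
  exact_mod_cast Nat.lt_two_pow_self.le

theorem exists_dominating_assocN (hM2 : CondM2' Mp) {r s : ℕ → ℝ} (hr : InRcal r)
    (hs : InRcal s) (n : ℕ) :
    ∃ k, InRcal k ∧ ∃ D, ∀ ρ, 0 < ρ →
      n * (assocN Mp r ρ + assocN Mp s ρ) ≤ assocN Mp k ρ + D := by
  obtain ⟨k, hk, D, h⟩ :=
    exists_nat_mul_assocN_le hMpos hM0 hM1 hM2 (hr.min hs) (n * 2)
  refine ⟨k, hk, D, fun ρ hρ => le_trans ?_ (h ρ hρ)⟩
  have h1 := assocN_anti hMpos hM0 hM1 (hr.min hs) hr (fun i => min_le_left _ _) hρ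
  have h2 := assocN_anti hMpos hM0 hM1 (hr.min hs) hs (fun i => min_le_right _ _) hρ
  push_cast
  rw [mul_assoc]
  refine mul_le_mul_of_nonneg_left ?_ (Nat.cast_nonneg n)
  linarith

end AssociatedFunction

section IteratedDerivatives

variable {d : ℕ}

/-- The iterated partial derivative along a list of coordinate directions. -/
noncomputable def lderiv (l : List (Fin d)) (f : EuclideanSpace ℝ (Fin d) → ℂ) :
    EuclideanSpace ℝ (Fin d) → ℂ :=
  l.foldr pderiv1 f

theorem lderiv_cons (j : Fin d) (l : List (Fin d)) (f : EuclideanSpace ℝ (Fin d) → ℂ) :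
    lderiv (j :: l) f = pderiv1 j (lderiv l f) := rfl

theorem lderiv_append (l l' : List (Fin d)) (f : EuclideanSpace ℝ (Fin d) → ℂ) :
    lderiv (l ++ l') f = lderiv l (lderiv l' f) := List.foldr_append

theorem lderiv_replicate (n : ℕ) (j : Fin d) (f : EuclideanSpace ℝ (Fin d) → ℂ) :
    lderiv (List.replicate n j) f = (pderiv1 j)^[n] f := by
  induction n with
  | zero => rfl
  | succ n ih => rw [List.replicate_succ, lderiv_cons, ih, Function.iterate_succ_apply']

theorem ContDiff.pderiv1 {f : EuclideanSpace ℝ (Fin d) → ℂ} (hf : ContDiff ℝ (⊤ : ℕ∞) f)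
    (j : Fin d) : ContDiff ℝ (⊤ : ℕ∞) (pderiv1 j f) :=
  (hf.fderiv_right (m := (⊤ : ℕ∞)) (by simp)).clm_apply contDiff_const

theorem ContDiff.lderiv {f : EuclideanSpace ℝ (Fin d) → ℂ} (hf : ContDiff ℝ (⊤ : ℕ∞) f)
    (l : List (Fin d)) : ContDiff ℝ (⊤ : ℕ∞) (lderiv l f) := by
  induction l with
  | nil => exact hf
  | cons j l ih => exact ih.pderiv1 j

theorem pderiv1_comm {f : EuclideanSpace ℝ (Fin d) → ℂ} (hf : ContDiff ℝ (⊤ : ℕ∞) f)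
    (i j : Fin d) : pderiv1 i (pderiv1 j f) = pderiv1 j (pderiv1 i f) := by
  have hd : Differentiable ℝ (fderiv ℝ f) :=
    (hf.fderiv_right (m := (⊤ : ℕ∞)) (by simp)).differentiable (by simp)
  have key : ∀ (v w : EuclideanSpace ℝ (Fin d)) x,
      fderiv ℝ (fun y => fderiv ℝ f y v) x w = fderiv ℝ (fderiv ℝ f) x w v := by
    intro v w x
    have h := (hd x).hasFDerivAt.clm_apply (hasFDerivAt_const v x)
    rw [h.fderiv]
    simp
  ext x
  unfold pderiv1
  rw [key, key]
  exact second_derivative_symmetric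
    (fun y => ((hf.differentiable (by simp)) y).hasFDerivAt) (hd x).hasFDerivAt _ _

theorem List.Perm.lderiv_eq {l l' : List (Fin d)} (h : l.Perm l')
    {f : EuclideanSpace ℝ (Fin d) → ℂ} (hf : ContDiff ℝ (⊤ : ℕ∞) f) :
    lderiv l f = lderiv l' f := by
  induction h with
  | nil => rfl
  | cons j _ ih => rw [lderiv_cons, lderiv_cons, ih]
  | swap i j l => exact pderiv1_comm (hf.lderiv l) j i
  | trans _ _ ih ih' => exact ih.trans ih'

theorem mderiv_eq_lderiv (α : Fin d → ℕ) (f : EuclideanSpace ℝ (Fin d) → ℂ) :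
    mderiv α f = lderiv ((List.finRange d).flatMap fun j => List.replicate (α j) j) f := by
  unfold mderiv
  induction List.finRange d with
  | nil => rfl
  | cons j l ih =>
    rw [List.foldr_cons, ih, List.flatMap_cons, lderiv_append, lderiv_replicate]

theorem exists_list_mderiv_eq (α : Fin d → ℕ) :
    ∃ l : List (Fin d), l.length = ∑ j, α j ∧
      ∀ f : EuclideanSpace ℝ (Fin d) → ℂ, mderiv α f = lderiv l f := by
  refine ⟨_, ?_, mderiv_eq_lderiv α⟩
  simp [List.length_flatMap, Fin.sum_univ_def]

theorem lderiv_eq_mderiv (l : List (Fin d)) {f : EuclideanSpace ℝ (Fin d) → ℂ}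
    (hf : ContDiff ℝ (⊤ : ℕ∞) f) : lderiv l f = mderiv (fun j => l.count j) f := by
  rw [mderiv_eq_lderiv]
  refine List.Perm.lderiv_eq (List.perm_iff_count.2 fun j => ?_) hf
  rw [List.count_flatMap]
  simp only [Function.comp_def, List.count_replicate]
  rw [← Fin.sum_univ_def]
  simp

theorem sum_count_eq_length (l : List (Fin d)) : ∑ j, l.count j = l.length := by
  simpa using Multiset.sum_count_eq_card (s := Finset.univ) (m := (l : Multiset (Fin d)))
    fun j _ => Finset.mem_univ j

theorem pderiv1_conj (j : Fin d) (f : EuclideanSpace ℝ (Fin d) → ℂ) :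
    pderiv1 j (fun x => (starRingEnd ℂ) (f x)) = fun x => (starRingEnd ℂ) (pderiv1 j f x) := by
  ext x
  have h := Complex.conjCLE.comp_fderiv (f := f) (x := x)
  exact congrArg (fun L => L (EuclideanSpace.single j 1)) h

theorem lderiv_conj (l : List (Fin d)) (f : EuclideanSpace ℝ (Fin d) → ℂ) :
    lderiv l (fun x => (starRingEnd ℂ) (f x)) = fun x => (starRingEnd ℂ) (lderiv l f x) := by
  induction l with
  | nil => rfl
  | cons j l ih => rw [lderiv_cons, ih, pderiv1_conj, lderiv_cons]

theorem contDiff_conj {f : EuclideanSpace ℝ (Fin d) → ℂ} (hf : ContDiff ℝ (⊤ : ℕ∞) f) :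
    ContDiff ℝ (⊤ : ℕ∞) fun x => (starRingEnd ℂ) (f x) :=
  Complex.conjCLE.contDiff.comp hf

theorem tsupport_lderiv_subset (l : List (Fin d)) (f : EuclideanSpace ℝ (Fin d) → ℂ) :
    tsupport (lderiv l f) ⊆ tsupport f := by
  induction l with
  | nil => exact subset_rfl
  | cons j l ih => exact (tsupport_fderiv_apply_subset ℝ _).trans ih

theorem norm_fderiv_le_sum_pderiv1 (f : EuclideanSpace ℝ (Fin d) → ℂ)
    (x : EuclideanSpace ℝ (Fin d)) : ‖fderiv ℝ f x‖ ≤ ∑ j, ‖pderiv1 j f x‖ := by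
  refine ContinuousLinearMap.opNorm_le_bound _ (Finset.sum_nonneg fun _ _ => norm_nonneg _)
    fun v => ?_
  have hv : v = ∑ j, v j • EuclideanSpace.single j (1 : ℝ) := by
    ext i
    simp [Finset.sum_apply, Pi.single_apply]
  conv_lhs => rw [hv, map_sum]
  rw [Finset.sum_mul]
  refine (norm_sum_le _ _).trans (Finset.sum_le_sum fun j _ => ?_)
  rw [map_smul, norm_smul, mul_comm]
  exact mul_le_mul_of_nonneg_left (PiLp.norm_apply_le v j) (norm_nonneg _)

theorem fderiv_eq_sum_pderiv1 (f : EuclideanSpace ℝ (Fin d) → ℂ) :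
    fderiv ℝ f = fun x => ∑ j, (EuclideanSpace.proj j : EuclideanSpace ℝ (Fin d) →L[ℝ] ℝ).smulRight
      (pderiv1 j f x) := by
  ext x v
  have hv : v = ∑ j, v j • EuclideanSpace.single j (1 : ℝ) := by
    ext i
    simp [Finset.sum_apply, Pi.single_apply]
  conv_lhs => rw [hv, map_sum]
  simp [pderiv1]

theorem contDiff_nat_succ_of_pderiv1 {n : ℕ} {f : EuclideanSpace ℝ (Fin d) → ℂ}
    (hf : Differentiable ℝ f) (h : ∀ j, ContDiff ℝ n (pderiv1 j f)) :
    ContDiff ℝ (n + 1 : ℕ) f := by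
  rw [Nat.cast_add, Nat.cast_one, contDiff_succ_iff_fderiv]
  refine ⟨hf, by simp, ?_⟩
  rw [fderiv_eq_sum_pderiv1]
  exact ContDiff.sum fun j _ => contDiff_const.smulRight (h j)

section Series

variable {a : ℕ → ℂ} (ha : Summable fun n => ‖a n‖) {g : ℕ → EuclideanSpace ℝ (Fin d) → ℂ}
  (hg : ∀ n, ContDiff ℝ (⊤ : ℕ∞) (g n))
  (hb : ∀ l : List (Fin d), ∃ B, ∀ n x, ‖lderiv l (g n) x‖ ≤ B)

include ha hg hb

theorem hasFDerivAt_tsum_mul (x : EuclideanSpace ℝ (Fin d)) :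
    HasFDerivAt (fun y => ∑' n, a n * g n y) (∑' n, a n • fderiv ℝ (g n) x) x ∧
      Summable fun n => a n • fderiv ℝ (g n) x := by
  choose B hB using hb
  have hbound : ∀ n x, ‖a n • fderiv ℝ (g n) x‖ ≤ ‖a n‖ * ∑ j : Fin d, B [j] := fun n x => by
    rw [norm_smul]
    refine mul_le_mul_of_nonneg_left ((norm_fderiv_le_sum_pderiv1 _ _).trans ?_) (norm_nonneg _)
    exact Finset.sum_le_sum fun j _ => hB [j] n x
  have hsum := ha.mul_right (∑ j : Fin d, B [j])
  refine ⟨hasFDerivAt_tsum hsum (fun n x => ?_) hbound (x₀ := 0) ?_ x,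
    Summable.of_norm_bounded hsum fun n => hbound n x⟩
  · exact (((hg n).differentiable (by simp)) x).hasFDerivAt.const_mul (a n)
  · refine Summable.of_norm_bounded (ha.mul_right (B [])) fun n => ?_
    rw [norm_mul]
    exact mul_le_mul_of_nonneg_left (hB [] n 0) (norm_nonneg _)

theorem pderiv1_tsum (j : Fin d) :
    pderiv1 j (fun y => ∑' n, a n * g n y) = fun y => ∑' n, a n * pderiv1 j (g n) y := by
  ext x
  obtain ⟨h, hs⟩ := hasFDerivAt_tsum_mul ha hg hb x
  unfold pderiv1
  rw [h.fderiv]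
  exact (ContinuousLinearMap.apply ℝ ℂ (EuclideanSpace.single j (1 : ℝ))).map_tsum hs

theorem lderiv_tsum (l : List (Fin d)) :
    lderiv l (fun y => ∑' n, a n * g n y) = fun y => ∑' n, a n * lderiv l (g n) y := by
  induction l with
  | nil => rfl
  | cons j l ih =>
    rw [lderiv_cons, ih, pderiv1_tsum ha (fun n => (hg n).lderiv l) fun l' => ?_]
    · rfl
    · obtain ⟨B, hB⟩ := hb (l' ++ l)
      exact ⟨B, fun n x => by rw [← lderiv_append]; exact hB n x⟩

theorem contDiff_tsum_mul : ContDiff ℝ (⊤ : ℕ∞) fun y => ∑' n, a n * g n y := by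
  rw [contDiff_infty]
  intro m
  induction m generalizing g with
  | zero =>
    exact contDiff_zero.2 (Differentiable.continuous (𝕜 := ℝ)
      fun x => (hasFDerivAt_tsum_mul ha hg hb x).1.differentiableAt)
  | succ m ih =>
    refine contDiff_nat_succ_of_pderiv1
      (fun x => (hasFDerivAt_tsum_mul ha hg hb x).1.differentiableAt) fun j => ?_
    rw [pderiv1_tsum ha hg hb]
    refine ih (fun n => (hg n).pderiv1 j) fun l => ?_
    obtain ⟨B, hB⟩ := hb (l ++ [j])
    exact ⟨B, fun n x => by exact (congrFun (lderiv_append l [j] (g n)) x).symm ▸ hB n x⟩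

end Series

end IteratedDerivatives

open MeasureTheory in
theorem pow_norm_le_of_lipschitz_of_integrable {d : ℕ} {g : EuclideanSpace ℝ (Fin d) → ℂ}
    {L : ℝ} (hL : 0 < L) (hg : ∀ x y, ‖g x - g y‖ ≤ L * ‖x - y‖)
    (hint : Integrable fun x => ‖g x‖ ^ 2) (x : EuclideanSpace ℝ (Fin d)) :
    ‖g x‖ ^ (d + 2) * volume.real (Metric.ball (0 : EuclideanSpace ℝ (Fin d)) 1) ≤
      2 ^ (d + 2) * L ^ d * ∫ y, ‖g y‖ ^ 2 := by
  have hI : 0 ≤ ∫ y, ‖g y‖ ^ 2 := integral_nonneg fun _ => by positivity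
  rcases (norm_nonneg (g x)).eq_or_lt with h0 | h0
  · rw [← h0]
    simp only [ne_eq, Nat.add_eq_zero_iff, OfNat.ofNat_ne_zero, and_false, not_false_eq_true,
      zero_pow, zero_mul]
    positivity
  set r := ‖g x‖ / (2 * L) with hr
  have hr0 : 0 < r := by positivity
  have hball : volume.real (Metric.ball x r) =
      r ^ d * volume.real (Metric.ball (0 : EuclideanSpace ℝ (Fin d)) 1) := by
    rw [measureReal_def, Measure.addHaar_ball_of_pos _ _ hr0, ENNReal.toReal_mul,
      ENNReal.toReal_ofReal (by positivity), finrank_euclideanSpace_fin, measureReal_def]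
  have hlow : ∀ y ∈ Metric.ball x r, (‖g x‖ / 2) ^ 2 ≤ ‖g y‖ ^ 2 := by
    intro y hy
    rw [mem_ball_iff_norm', lt_div_iff₀ (by positivity)] at hy
    have h1 := hg x y
    have h2 := norm_sub_norm_le (g x) (g y)
    have h3 : ‖g x‖ / 2 ≤ ‖g y‖ := by nlinarith
    gcongr
  have hkey : (‖g x‖ / 2) ^ 2 * volume.real (Metric.ball x r) ≤ ∫ y, ‖g y‖ ^ 2 := by
    calc (‖g x‖ / 2) ^ 2 * volume.real (Metric.ball x r)
        = ∫ _ in Metric.ball x r, (‖g x‖ / 2) ^ 2 := by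
          rw [setIntegral_const, smul_eq_mul, mul_comm]
      _ ≤ ∫ y in Metric.ball x r, ‖g y‖ ^ 2 :=
          setIntegral_mono_on (integrableOn_const measure_ball_lt_top.ne) hint.integrableOn
            measurableSet_ball hlow
      _ ≤ _ := setIntegral_le_integral hint (ae_of_all _ fun _ => by positivity)
  rw [hball] at hkey
  have hrL : ‖g x‖ = 2 * L * r := by rw [hr]; field_simp
  have := mul_le_mul_of_nonneg_left hkey (by positivity : 0 ≤ 2 ^ (d + 2) * L ^ d)
  refine le_trans (le_of_eq ?_) this
  rw [hrL, pow_add, mul_pow (2 * L) r, mul_pow 2 L, pow_add 2]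
  field_simp

open MeasureTheory in
theorem norm_integral_lderiv_mul {d : ℕ} (l : List (Fin d))
    {u v : EuclideanSpace ℝ (Fin d) → ℂ} (hu : ContDiff ℝ (⊤ : ℕ∞) u)
    (hv : ContDiff ℝ (⊤ : ℕ∞) v) (hsu : HasCompactSupport u) :
    ‖∫ x, lderiv l u x * v x‖ = ‖∫ x, u x * lderiv l.reverse v x‖ := by
  induction l generalizing v with
  | nil => rfl
  | cons j l ih =>
    have hU := hu.lderiv l
    have hsU : HasCompactSupport (lderiv l u) :=
      hsu.of_isClosed_subset (isClosed_tsupport _) (tsupport_lderiv_subset l u)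
    have hint : ∀ {p q : EuclideanSpace ℝ (Fin d) → ℂ}, ContDiff ℝ (⊤ : ℕ∞) p →
        ContDiff ℝ (⊤ : ℕ∞) q → HasCompactSupport p → Integrable fun x => p x * q x :=
      fun hp hq hs => (hp.continuous.mul hq.continuous).integrable_of_hasCompactSupport
        hs.mul_right
    have hsU' : HasCompactSupport (pderiv1 j (lderiv l u)) :=
      hsU.fderiv_apply ℝ (EuclideanSpace.single j (1 : ℝ))
    have h := integral_mul_fderiv_eq_neg_fderiv_mul_of_integrable (𝕜 := ℂ) (μ := volume)
      (f := lderiv l u) (g := v) (v := EuclideanSpace.single j (1 : ℝ))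
      (hint (hU.pderiv1 j) hv hsU') (hint hU (hv.pderiv1 j) hsU) (hint hU hv hsU)
      (fun x _ => hU.differentiable (by simp) x) (fun x _ => hv.differentiable (by simp) x)
    rw [lderiv_cons, List.reverse_cons, lderiv_append, ← ih (hv.lderiv [j])]
    have h' : ∫ x, lderiv l u x * pderiv1 j v x = -∫ x, pderiv1 j (lderiv l u) x * v x := h
    change _ = ‖∫ x, lderiv l u x * pderiv1 j v x‖
    rw [h', norm_neg]

theorem norm_coeff_le_of_tsum_bounded {c : ℕ → ℕ → ℂ} (hc : ∀ m, ∃ B, ∀ n, ‖c m n‖ ≤ B)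
    (h : ∀ a : ℕ → ℂ, (Summable fun n => ‖a n‖) → ∃ B, ∀ m, ‖∑' n, a n * c m n‖ ≤ B) :
    ∃ B, ∀ m n, ‖c m n‖ ≤ B := by
  choose B hB using hc
  have hsum : ∀ a : lp (fun _ : ℕ => ℂ) 1, Summable fun n => ‖a n‖ := fun a => by
    simpa using (lp.memℓp a).summable (by simp)
  have hnorm : ∀ a : lp (fun _ : ℕ => ℂ) 1, ‖a‖ = ∑' n, ‖a n‖ := fun a => by
    simpa using lp.norm_eq_tsum_rpow (by simp) a
  have hs : ∀ m (a : lp (fun _ : ℕ => ℂ) 1), Summable fun n => ‖a n * c m n‖ := fun m a =>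
    Summable.of_nonneg_of_le (fun _ => norm_nonneg _) (fun n => by
      rw [norm_mul]
      exact mul_le_mul_of_nonneg_left (hB m n) (norm_nonneg _)) ((hsum a).mul_right (B m))
  let T : ℕ → lp (fun _ : ℕ => ℂ) 1 →L[ℂ] ℂ := fun m =>
    LinearMap.mkContinuous
      { toFun := fun a => ∑' n, a n * c m n
        map_add' := fun a b => by
          rw [← (hs m a).of_norm.tsum_add (hs m b).of_norm]
          exact tsum_congr fun n => by simp [add_mul]
        map_smul' := fun z a => by
          rw [RingHom.id_apply, smul_eq_mul, ← tsum_mul_left]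
          exact tsum_congr fun n => by simp [mul_assoc] } (B m)
      fun a => by
        change ‖∑' n, a n * c m n‖ ≤ _
        rw [hnorm, ← tsum_mul_left]
        refine (norm_tsum_le_tsum_norm (hs m a)).trans
          ((hs m a).tsum_le_tsum (fun n => ?_) ((hsum a).mul_left _))
        rw [norm_mul, mul_comm]
        exact mul_le_mul_of_nonneg_right (hB m n) (norm_nonneg _)
  obtain ⟨C, hC⟩ := banach_steinhaus (g := T) fun a => h _ (hsum a)
  refine ⟨C, fun m n => ?_⟩
  have h1 := (T m).le_of_opNorm_le (hC m) (lp.single 1 n (1 : ℂ))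
  rw [lp.norm_single (by simp), norm_one, mul_one] at h1
  have h2 : T m (lp.single 1 n (1 : ℂ)) = c m n := by
    change ∑' i, (lp.single 1 n (1 : ℂ) : lp (fun _ : ℕ => ℂ) 1) i * c m i = _
    rw [tsum_eq_single n]
    · simp
    · intro i hi
      simp [hi]
  rwa [h2] at h1

theorem lderiv_const_mul {d : ℕ} (c : ℂ) (l : List (Fin d))
    (f : EuclideanSpace ℝ (Fin d) → ℂ) :
    lderiv l (fun x => c * f x) = fun x => c * lderiv l f x := by
  induction l with
  | nil => rfl
  | cons j l ih =>
    rw [lderiv_cons, ih]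
    ext x
    exact congrArg (fun F => F x (EuclideanSpace.single j (1 : ℝ)))
      (fderiv_const_smul_field (𝕜 := ℝ) (f := lderiv l f) c)

theorem lderiv_eq_zero_of_notMem {d : ℕ} {K : Set (EuclideanSpace ℝ (Fin d))}
    {f : EuclideanSpace ℝ (Fin d) → ℂ} (hf : tsupport f ⊆ K) (l : List (Fin d))
    {x : EuclideanSpace ℝ (Fin d)} (hx : x ∉ K) : lderiv l f x = 0 :=
  image_eq_zero_of_notMem_tsupport fun h => hx (hf (tsupport_lderiv_subset l f h))

theorem ModerateR.exists_lderiv_bound {d : ℕ} {Mp : ℕ → ℝ} (hMpos : ∀ p, 0 < Mp p)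
    {K : Set (EuclideanSpace ℝ (Fin d))} (hK : IsCompact K)
    {f : ℝ → EuclideanSpace ℝ (Fin d) → ℂ}
    (hsmooth : ∀ ε ∈ Set.Ioo (0 : ℝ) 1, ContDiff ℝ (⊤ : ℕ∞) (f ε))
    (hsupp : ∀ ε ∈ Set.Ioo (0 : ℝ) 1, tsupport (f ε) ⊆ K)
    (hmod : ModerateR Mp f) {h : ℕ → ℝ} (hh : InRcal h) :
    ∃ k, InRcal k ∧ ∃ C : ℝ, 0 < C ∧ ∃ ε₀ ∈ Set.Ioo (0 : ℝ) 1, ∀ ε, 0 < ε → ε < ε₀ →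
      ∀ x l, ‖lderiv l (f ε) x‖ ≤ C * Real.exp (assocN Mp k (1 / ε)) *
        (Mp l.length * ∏ i ∈ Finset.range l.length, h i) := by
  obtain ⟨k, hk, C, hC, ε₀, hε₀, hb⟩ := hmod K hK h hh
  refine ⟨k, hk, C, hC, ε₀, hε₀, fun ε h0 h1 x l => ?_⟩
  have hε : ε ∈ Set.Ioo (0 : ℝ) 1 := ⟨h0, h1.trans hε₀.2⟩
  have hpos : 0 < Mp l.length * ∏ i ∈ Finset.range l.length, h i :=
    mul_pos (hMpos _) (hh.prod_pos _)
  by_cases hx : x ∈ K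
  · have := hb ε h0 h1 x hx fun j => l.count j
    rwa [sum_count_eq_length, ← lderiv_eq_mderiv l (hsmooth ε hε), div_le_iff₀ hpos] at this
  · rw [lderiv_eq_zero_of_notMem (hsupp ε hε) l hx, norm_zero]
    positivity

theorem exists_mderiv_bound_of_lderiv {d : ℕ} {Mp r : ℕ → ℝ} {B : ℝ}
    {φ : EuclideanSpace ℝ (Fin d) → ℂ}
    (h : ∀ x l, ‖lderiv l φ x‖ ≤ B * (Mp l.length * ∏ i ∈ Finset.range l.length, r i)) :
    ∃ B : ℝ, ∀ (x : EuclideanSpace ℝ (Fin d)) (α : Fin d → ℕ),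
      ‖mderiv α φ x‖ ≤ B * (Mp (∑ j, α j) * ∏ i ∈ Finset.range (∑ j, α j), r i) := by
  refine ⟨B, fun x α => ?_⟩
  obtain ⟨l, hl, hα⟩ := exists_list_mderiv_eq α
  rw [hα, ← hl]
  exact h x l

open MeasureTheory in
theorem integral_mul_tsum {d : ℕ} {u : EuclideanSpace ℝ (Fin d) → ℂ} (hu : Continuous u)
    (hsu : HasCompactSupport u) {g : ℕ → EuclideanSpace ℝ (Fin d) → ℂ}
    (hg : ∀ n, Continuous (g n)) (hg1 : ∀ n x, ‖g n x‖ ≤ 1) {a : ℕ → ℂ}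
    (ha : Summable fun n => ‖a n‖) :
    ∫ x, u x * ∑' n, a n * g n x = ∑' n, a n * ∫ x, u x * g n x := by
  have hint : ∀ n, Integrable fun x => a n * (u x * g n x) := fun n =>
    ((hu.mul (hg n)).integrable_of_hasCompactSupport hsu.mul_right).const_mul (a n)
  have hnorm : Integrable fun x => ‖u x‖ :=
    (hu.integrable_of_hasCompactSupport hsu).norm
  have hsum : Summable fun n => ∫ x, ‖a n * (u x * g n x)‖ := by
    refine Summable.of_nonneg_of_le (fun n => integral_nonneg fun _ => norm_nonneg _)
      (fun n => ?_) (ha.mul_right (∫ x, ‖u x‖))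
    rw [← integral_const_mul]
    refine integral_mono (hint n).norm (hnorm.const_mul _) fun x => ?_
    dsimp only
    rw [norm_mul, norm_mul]
    exact mul_le_mul_of_nonneg_left
      (mul_le_of_le_one_right (norm_nonneg _) (hg1 n x)) (norm_nonneg _)
  have h := integral_tsum_of_summable_integral_norm hint hsum
  simp only [integral_const_mul] at h
  rw [h]
  refine integral_congr_ae (Filter.Eventually.of_forall fun x => ?_)
  dsimp only
  rw [← tsum_mul_left]
  exact tsum_congr fun n => by ring

open MeasureTheory in
theorem norm_integral_mul_le {d : ℕ} {u v : EuclideanSpace ℝ (Fin d) → ℂ} (hu : Continuous u)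
    (hsu : HasCompactSupport u) {B : ℝ} (hv : ∀ x, ‖v x‖ ≤ B) :
    ‖∫ x, u x * v x‖ ≤ (∫ x, ‖u x‖) * B := by
  rw [← integral_mul_const]
  refine norm_integral_le_of_norm_le
    ((hu.integrable_of_hasCompactSupport hsu).norm.mul_const B)
    (Filter.Eventually.of_forall fun x => ?_)
  rw [norm_mul]
  exact mul_le_mul_of_nonneg_left (hv x) (norm_nonneg _)

open MeasureTheory in
theorem integral_mul_conj_self {d : ℕ} (u : EuclideanSpace ℝ (Fin d) → ℂ) :
    ∫ x, u x * (starRingEnd ℂ) (u x) = ((∫ x, ‖u x‖ ^ 2 : ℝ) : ℂ) := by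
  rw [← integral_complex_ofReal]
  exact integral_congr_ae (Filter.Eventually.of_forall fun x => by simp [Complex.mul_conj'])

open MeasureTheory in
theorem exists_integral_norm_sq_le {d : ℕ} {Mp : ℕ → ℝ} (hMpos : ∀ p, 0 < Mp p) (hM0 : Mp 0 = 1)
    (hM1 : CondM1 Mp) (hM2 : CondM2' Mp)
    {K : Set (EuclideanSpace ℝ (Fin d))} (hK : IsCompact K)
    {f : ℝ → EuclideanSpace ℝ (Fin d) → ℂ}
    (hsmooth : ∀ ε ∈ Set.Ioo (0 : ℝ) 1, ContDiff ℝ (⊤ : ℕ∞) (f ε))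
    (hsupp : ∀ ε ∈ Set.Ioo (0 : ℝ) 1, tsupport (f ε) ⊆ K)
    (hmod : ModerateR Mp f) {r : ℕ → ℝ} (hr : InRcal r)
    (hweak : ∀ φ : EuclideanSpace ℝ (Fin d) → ℂ, ContDiff ℝ (⊤ : ℕ∞) φ → tsupport φ ⊆ K →
      (∃ B : ℝ, ∀ (x : EuclideanSpace ℝ (Fin d)) (α : Fin d → ℕ),
        ‖mderiv α φ x‖ ≤ B * (Mp (∑ j, α j) * ∏ i ∈ Finset.range (∑ j, α j), r i)) →
      ∀ k : ℕ → ℝ, InRcal k → ∃ C : ℝ, 0 < C ∧ ∃ ε₀ ∈ Set.Ioo (0 : ℝ) 1,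
        ∀ ε : ℝ, 0 < ε → ε < ε₀ →
          ‖∫ x : EuclideanSpace ℝ (Fin d), f ε x * φ x‖ ≤
            C * Real.exp (-assocN Mp k (1 / ε)))
    {k : ℕ → ℝ} (hk : InRcal k) :
    ∃ C : ℝ, 0 < C ∧ ∃ ε₀ ∈ Set.Ioo (0 : ℝ) 1, ∀ ε, 0 < ε → ε < ε₀ →
      ∫ x, ‖f ε x‖ ^ 2 ≤ C * Real.exp (-assocN Mp k (1 / ε)) := by
  by_contra! hcon
  obtain ⟨k', hk', C₁, hC₁, ε₁, hε₁, hb⟩ :=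
    hmod.exists_lderiv_bound hMpos hK hsmooth hsupp hr
  obtain ⟨k₂, hk₂, D, hD⟩ := exists_dominating_assocN hMpos hM0 hM1 hM2 hk hk' 1
  have hseq : ∀ n : ℕ, ∃ ε, 0 < ε ∧ ε < min ε₁ (1 / (n + 1)) ∧
      (n + 1) * Real.exp (-assocN Mp k (1 / ε)) < ∫ x, ‖f ε x‖ ^ 2 := fun n =>
    hcon (n + 1) (by positivity) _
      ⟨lt_min hε₁.1 (by positivity), (min_le_left _ _).trans_lt hε₁.2⟩
  choose e he0 he1 he2 using hseq
  have heε₁ : ∀ n, e n < ε₁ := fun n => (he1 n).trans_le (min_le_left _ _)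
  have hI : ∀ n, e n ∈ Set.Ioo (0 : ℝ) 1 := fun n => ⟨he0 n, (heε₁ n).trans hε₁.2⟩
  have hcs : ∀ n, HasCompactSupport (f (e n)) := fun n =>
    hK.of_isClosed_subset (isClosed_tsupport _) (hsupp _ (hI n))
  have hcont : ∀ n, Continuous (f (e n)) := fun n => (hsmooth _ (hI n)).continuous
  set A : ℕ → ℝ := fun n => C₁ * Real.exp (assocN Mp k' (1 / e n)) with hA
  have hA0 : ∀ n, 0 < A n := fun n => by positivity
  set g : ℕ → EuclideanSpace ℝ (Fin d) → ℂ :=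
    fun n x => ((A n)⁻¹ : ℂ) * (starRingEnd ℂ) (f (e n) x) with hgdef
  have hgs : ∀ n, ContDiff ℝ (⊤ : ℕ∞) (g n) := fun n =>
    contDiff_const.mul (contDiff_conj (hsmooth _ (hI n)))
  have hgl : ∀ n x l, ‖lderiv l (g n) x‖ ≤
      Mp l.length * ∏ i ∈ Finset.range l.length, r i := by
    intro n x l
    rw [hgdef, lderiv_const_mul, lderiv_conj, norm_mul, RCLike.norm_conj, norm_inv,
      Complex.norm_real, Real.norm_of_nonneg (hA0 n).le, inv_mul_le_iff₀ (hA0 n)]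
    exact hb (e n) (he0 n) (heε₁ n) x l
  have hg1 : ∀ n x, ‖g n x‖ ≤ 1 := fun n x => by
    have := hgl n x []
    simpa [hM0, lderiv] using this
  set c : ℕ → ℕ → ℂ := fun m n =>
    (Real.exp (assocN Mp k₂ (1 / e m)) : ℂ) * ∫ x, f (e m) x * g n x with hc
  have hnormexp : ∀ y : ℝ, ‖(Real.exp y : ℂ)‖ = Real.exp y := fun y => by
    rw [Complex.norm_real, Real.norm_of_nonneg (Real.exp_pos y).le]
  obtain ⟨B, hB⟩ : ∃ B, ∀ m n, ‖c m n‖ ≤ B := by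
    refine norm_coeff_le_of_tsum_bounded (fun m => ?_) fun a ha => ?_
    · refine ⟨Real.exp (assocN Mp k₂ (1 / e m)) * ((∫ x, ‖f (e m) x‖) * 1), fun n => ?_⟩
      rw [hc, norm_mul, hnormexp]
      exact mul_le_mul_of_nonneg_left (norm_integral_mul_le (hcont m) (hcs m) (hg1 n))
        (Real.exp_pos _).le
    · set φ : EuclideanSpace ℝ (Fin d) → ℂ := fun x => ∑' n, a n * g n x with hφ
      have hbd : ∀ l : List (Fin d), ∃ B, ∀ n x, ‖lderiv l (g n) x‖ ≤ B :=
        fun l => ⟨_, fun n x => hgl n x l⟩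
      have hφs : ContDiff ℝ (⊤ : ℕ∞) φ := contDiff_tsum_mul ha hgs hbd
      have hφK : tsupport φ ⊆ K := by
        refine closure_minimal (fun x hx => ?_) hK.isClosed
        by_contra hxK
        refine hx ?_
        have h0 : ∀ n, f (e n) x = 0 := fun n =>
          image_eq_zero_of_notMem_tsupport fun h => hxK (hsupp _ (hI n) h)
        simp [hφ, hgdef, h0]
      have hφb : ∀ x l, ‖lderiv l φ x‖ ≤ (∑' n, ‖a n‖) *
          (Mp l.length * ∏ i ∈ Finset.range l.length, r i) := by
        intro x l
        rw [hφ, lderiv_tsum ha hgs hbd, ← tsum_mul_right]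
        refine tsum_of_norm_bounded (ha.mul_right _).hasSum fun n => ?_
        rw [norm_mul]
        exact mul_le_mul_of_nonneg_left (hgl n x l) (norm_nonneg _)
      obtain ⟨C, hC, ε₂, hε₂, hw⟩ :=
        hweak φ hφs hφK (exists_mderiv_bound_of_lderiv hφb) k₂ hk₂
      have hsum : ∀ m, ∑' n, a n * c m n =
          (Real.exp (assocN Mp k₂ (1 / e m)) : ℂ) * ∫ x, f (e m) x * φ x := by
        intro m
        rw [hφ, integral_mul_tsum (hcont m) (hcs m) (fun n => (hgs n).continuous) hg1 ha,
          ← tsum_mul_left]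
        exact tsum_congr fun n => by rw [hc]; ring
      obtain ⟨n₀, hn₀⟩ := exists_nat_one_div_lt hε₂.1
      refine ⟨C + ∑ m ∈ Finset.range n₀, ‖∑' n, a n * c m n‖, fun m => ?_⟩
      rcases lt_or_ge m n₀ with hm | hm
      · have := Finset.single_le_sum (f := fun m => ‖∑' n, a n * c m n‖)
          (fun _ _ => norm_nonneg _) (Finset.mem_range.2 hm)
        linarith
      · have hle : e m < ε₂ := by
          refine ((he1 m).trans_le (min_le_right _ _)).trans_le (le_trans ?_ hn₀.le)
          exact one_div_le_one_div_of_le (by positivity) (by gcongr)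
        have h1 : ‖∑' n, a n * c m n‖ ≤ C := by
          rw [hsum, norm_mul, hnormexp]
          calc _ ≤ Real.exp (assocN Mp k₂ (1 / e m)) *
                (C * Real.exp (-assocN Mp k₂ (1 / e m))) :=
                mul_le_mul_of_nonneg_left (hw _ (he0 m) hle) (Real.exp_pos _).le
            _ = C := by rw [Real.exp_neg]; field_simp
        have h2 : 0 ≤ ∑ m ∈ Finset.range n₀, ‖∑' n, a n * c m n‖ :=
          Finset.sum_nonneg fun _ _ => norm_nonneg _
        linarith
  obtain ⟨m, hm⟩ := exists_nat_ge (B * (C₁ * Real.exp D))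
  have hdiag : c m m = ((Real.exp (assocN Mp k₂ (1 / e m)) *
      ((A m)⁻¹ * ∫ x, ‖f (e m) x‖ ^ 2) : ℝ) : ℂ) := by
    have : ∫ x, f (e m) x * g m x =
        ((A m)⁻¹ : ℂ) * ∫ x, f (e m) x * (starRingEnd ℂ) (f (e m) x) := by
      rw [← integral_const_mul]
      exact integral_congr_ae (Filter.Eventually.of_forall fun x => by simp only [hgdef]; ring)
    simp only [hc]
    rw [this, integral_mul_conj_self]
    push_cast
    ring
  have hI0 : 0 ≤ ∫ x, ‖f (e m) x‖ ^ 2 := integral_nonneg fun _ => by positivity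
  have hBm := hB m m
  have hAm := hA0 m
  rw [hdiag, Complex.norm_real, Real.norm_of_nonneg (by positivity)] at hBm
  have hB0 : 0 ≤ B := le_trans (by positivity) hBm
  have hD' := hD (1 / e m) (one_div_pos.2 (he0 m))
  have h2 := he2 m
  set J := ∫ x, ‖f (e m) x‖ ^ 2
  set N := assocN Mp k (1 / e m)
  set N' := assocN Mp k' (1 / e m)
  set N₂ := assocN Mp k₂ (1 / e m)
  have hJ : J ≤ B * (C₁ * Real.exp D) * Real.exp (-N) := by
    have h3 : J = Real.exp N₂ * ((A m)⁻¹ * J) * (A m * Real.exp (-N₂)) := by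
      rw [Real.exp_neg]
      field_simp
    rw [h3]
    calc _ ≤ B * (A m * Real.exp (-N₂)) := mul_le_mul_of_nonneg_right hBm (by positivity)
      _ = B * C₁ * Real.exp (N' - N₂) := by
        rw [hA, sub_eq_add_neg, Real.exp_add]; ring
      _ ≤ B * C₁ * Real.exp (D + -N) := by
        refine mul_le_mul_of_nonneg_left (Real.exp_le_exp.2 ?_) (by positivity)
        push_cast at hD'
        linarith
      _ = _ := by rw [Real.exp_add]; ring
  have h4 := mul_le_mul_of_nonneg_right (hm.trans (by linarith : (m : ℝ) ≤ m + 1))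
    (Real.exp_pos (-N)).le
  linarith

open MeasureTheory in
theorem integrable_norm_sq {d : ℕ} {u : EuclideanSpace ℝ (Fin d) → ℂ}
    (hu : Continuous u) (hcs : HasCompactSupport u) : Integrable fun x => ‖u x‖ ^ 2 :=
  Continuous.integrable_of_hasCompactSupport (by fun_prop)
    (hcs.mono fun x hx => by simpa using hx)

open MeasureTheory in
theorem integral_norm_le_of_integral_norm_sq {d : ℕ} {u : EuclideanSpace ℝ (Fin d) → ℂ}
    (hu : Continuous u) {K : Set (EuclideanSpace ℝ (Fin d))} (hK : IsCompact K)
    (hsupp : tsupport u ⊆ K) {δ : ℝ} (hδ : 0 < δ) :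
    ∫ x, ‖u x‖ ≤ δ * volume.real K + (∫ x, ‖u x‖ ^ 2) / δ := by
  have hcs : HasCompactSupport u := hK.of_isClosed_subset (isClosed_tsupport _) hsupp
  have hsq := integrable_norm_sq hu hcs
  have hind : Integrable (K.indicator fun _ => δ) :=
    (integrable_indicator_iff hK.measurableSet).2 (integrableOn_const hK.measure_lt_top.ne)
  have h1 : ∫ x, (K.indicator (fun _ => δ) x + ‖u x‖ ^ 2 / δ) =
      δ * volume.real K + (∫ x, ‖u x‖ ^ 2) / δ := by
    rw [integral_add hind (hsq.div_const δ), integral_indicator hK.measurableSet,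
      setIntegral_const, integral_div, smul_eq_mul, mul_comm]
  rw [← h1]
  refine integral_mono (hu.integrable_of_hasCompactSupport hcs).norm
    (hind.add (hsq.div_const δ)) fun x => ?_
  by_cases hx : x ∈ K
  · simp only [Set.indicator_of_mem hx]
    have h2 : δ + ‖u x‖ ^ 2 / δ - ‖u x‖ = ((‖u x‖ - δ / 2) ^ 2 + 3 / 4 * δ ^ 2) / δ := by
      field_simp
      ring
    have h3 : 0 ≤ ((‖u x‖ - δ / 2) ^ 2 + 3 / 4 * δ ^ 2) / δ := by positivity
    linarith
  · have h0 : u x = 0 := image_eq_zero_of_notMem_tsupport fun h => hx (hsupp h)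
    simp [Set.indicator_of_notMem hx, h0]

open MeasureTheory in
theorem integral_norm_sq_lderiv_le {d : ℕ} {Mp : ℕ → ℝ} {c₀ H : ℝ}
    (hH : 0 < H) (hM2 : CondM2 Mp c₀ H) {h : ℕ → ℝ} (hh : InRcal h)
    {u : EuclideanSpace ℝ (Fin d) → ℂ} (hu : ContDiff ℝ (⊤ : ℕ∞) u) (hcs : HasCompactSupport u)
    {Y : ℝ} (hY : 0 < Y)
    (hb : ∀ x l, ‖lderiv l u x‖ ≤
      Y * (Mp l.length * ∏ i ∈ Finset.range l.length, h (i / 2) / H)) (l : List (Fin d)) :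
    ∫ x, ‖lderiv l u x‖ ^ 2 ≤
      (∫ x, ‖u x‖) * (Y * c₀ * (Mp l.length * ∏ i ∈ Finset.range l.length, h i) ^ 2) := by
  set n := l.length
  have hP := hh.prod_pos n
  set P := ∏ i ∈ Finset.range n, h i
  have hrev : ∀ x, ‖lderiv l.reverse (fun x => (starRingEnd ℂ) (lderiv l u x)) x‖ ≤
      Y * c₀ * (Mp n * P) ^ 2 := by
    intro x
    rw [lderiv_conj, RCLike.norm_conj, ← lderiv_append]
    refine (hb x _).trans ?_
    rw [List.length_append, List.length_reverse, ← two_mul, prod_range_halve]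
    have h1 := hM2 n n
    rw [← two_mul] at h1
    calc Y * (Mp (2 * n) * (P ^ 2 / H ^ (2 * n)))
        ≤ Y * ((c₀ * H ^ (2 * n) * Mp n * Mp n) * (P ^ 2 / H ^ (2 * n))) := by gcongr
      _ = Y * c₀ * (Mp n * P) ^ 2 := by
        field_simp
  have h1 : ∫ x, ‖lderiv l u x‖ ^ 2 =
      ‖∫ x, lderiv l u x * (starRingEnd ℂ) (lderiv l u x)‖ := by
    rw [integral_mul_conj_self, Complex.norm_real,
      Real.norm_of_nonneg (integral_nonneg fun _ => by positivity)]
  rw [h1, norm_integral_lderiv_mul l hu (contDiff_conj (hu.lderiv l)) hcs]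
  exact norm_integral_mul_le hu.continuous hcs hrev

theorem norm_lderiv_sub_le {d : ℕ} {Mp : ℕ → ℝ} (hMpos : ∀ p, 0 < Mp p) {c₀ H : ℝ}
    (hH : 0 < H) (hM2 : CondM2 Mp c₀ H) {h : ℕ → ℝ} (hh : InRcal h)
    {u : EuclideanSpace ℝ (Fin d) → ℂ} (hu : ContDiff ℝ (⊤ : ℕ∞) u) {Y : ℝ} (hY : 0 < Y)
    (hb : ∀ x l, ‖lderiv l u x‖ ≤
      Y * (Mp l.length * ∏ i ∈ Finset.range l.length, h (i / 2) / H)) (l : List (Fin d))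
    (x y : EuclideanSpace ℝ (Fin d)) :
    ‖lderiv l u x - lderiv l u y‖ ≤ (d + 1) * (c₀ * Mp 1 * h 0 * Y *
      (Mp l.length * ∏ i ∈ Finset.range l.length, h i)) * ‖x - y‖ := by
  refine Convex.norm_image_sub_le_of_norm_fderiv_le (𝕜 := ℝ) (s := Set.univ)
    (fun z _ => (hu.lderiv l).differentiable (by simp) z) (fun z _ => ?_) convex_univ
    (Set.mem_univ y) (Set.mem_univ x)
  set n := l.length
  set P := ∏ i ∈ Finset.range n, h i
  have hj : ∀ j, ‖pderiv1 j (lderiv l u) z‖ ≤ c₀ * Mp 1 * h 0 * Y * (Mp n * P) := by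
    intro j
    refine (hb z (j :: l)).trans ?_
    rw [List.length_cons]
    have h1 := hM2 n 1
    have h2 := prod_range_succ_halve_le hh hH n
    have h3 := ((hh.halve hH).prod_pos (n + 1)).le
    have h4 := (hMpos (n + 1)).le.trans h1
    calc Y * (Mp (n + 1) * ∏ i ∈ Finset.range (n + 1), h (i / 2) / H)
        ≤ Y * ((c₀ * H ^ (n + 1) * Mp n * Mp 1) * (h 0 * P / H ^ (n + 1))) :=
          mul_le_mul_of_nonneg_left (mul_le_mul h1 h2 h3 h4) hY.le
      _ = c₀ * Mp 1 * h 0 * Y * (Mp n * P) := by field_simp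
  have hB : 0 ≤ c₀ * Mp 1 * h 0 * Y * (Mp n * P) := by
    have h1 := (hMpos (0 + 0)).trans_le (hM2 0 0)
    have h2 := hMpos 0
    have h3 := hMpos 1
    have h4 := hh.1 0
    have h5 := hMpos n
    have h6 : 0 < P := hh.prod_pos n
    have hc₀ : 0 < c₀ := by
      rw [add_zero, pow_zero, mul_one] at h1
      exact pos_of_mul_pos_left (pos_of_mul_pos_left h1 h2.le) h2.le
    positivity
  refine (norm_fderiv_le_sum_pderiv1 _ z).trans ((Finset.sum_le_sum fun j _ => hj j).trans ?_)
  rw [Finset.sum_const, Finset.card_univ, Fintype.card_fin, nsmul_eq_mul, add_one_mul]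
  exact le_add_of_nonneg_right hB

theorem stmt14 {d : ℕ} (Mp : ℕ → ℝ) (hMpos : ∀ p, 0 < Mp p) (hM0 : Mp 0 = 1)
    (hM1 : CondM1 Mp) (hM2 : CondM2' Mp) (hM3 : CondM3 Mp)
    (K : Set (EuclideanSpace ℝ (Fin d))) (hK : IsCompact K)
    (f : ℝ → EuclideanSpace ℝ (Fin d) → ℂ)
    (hsmooth : ∀ ε ∈ Set.Ioo (0 : ℝ) 1, ContDiff ℝ (⊤ : ℕ∞) (f ε))
    (hsupp : ∀ ε ∈ Set.Ioo (0 : ℝ) 1, tsupport (f ε) ⊆ K)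
    (hmod : ModerateR Mp f)
    (hweak : ∃ rt : ℕ → ℝ, InRcal rt ∧ ∃ K₁ : Set (EuclideanSpace ℝ (Fin d)),
      IsCompact K₁ ∧ K ⊆ interior K₁ ∧
      ∀ φ : EuclideanSpace ℝ (Fin d) → ℂ, ContDiff ℝ (⊤ : ℕ∞) φ → tsupport φ ⊆ K₁ →
        (∃ B : ℝ, ∀ (x : EuclideanSpace ℝ (Fin d)) (α : Fin d → ℕ),
          ‖mderiv α φ x‖ ≤ B * (Mp (∑ j, α j) * ∏ i ∈ Finset.range (∑ j, α j), rt i)) →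
        ∀ k : ℕ → ℝ, InRcal k → ∃ C : ℝ, 0 < C ∧ ∃ ε₀ ∈ Set.Ioo (0 : ℝ) 1,
          ∀ ε : ℝ, 0 < ε → ε < ε₀ →
            ‖∫ x : EuclideanSpace ℝ (Fin d), f ε x * φ x‖ ≤
              C * Real.exp (-assocN Mp k (1 / ε))) :
    NegligibleR Mp f := by
  obtain ⟨r, hr, K₁, hK₁, hKK₁, hw⟩ := hweak
  have hKsub : K ⊆ K₁ := hKK₁.trans interior_subset
  obtain ⟨c₀, H, hc₀, hH, hM2'⟩ := id hM2
  have hH0 : 0 < H := by linarith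
  have hc00 : 0 < c₀ := by linarith
  intro K' _ h hh k hk
  obtain ⟨k₂, hk₂, C₂, hC₂, ε₂, hε₂, hb⟩ :=
    hmod.exists_lderiv_bound hMpos hK hsmooth hsupp (hh.halve hH0)
  obtain ⟨k₃, hk₃, D, hD⟩ :=
    exists_dominating_assocN hMpos hM0 hM1 hM2 hk₂ hk (2 * (d + 2))
  obtain ⟨C₃, hC₃, ε₃, hε₃, hL2⟩ :=
    exists_integral_norm_sq_le hMpos hM0 hM1 hM2 hK hsmooth hsupp hmod hr
      (fun φ hφ hφK => hw φ hφ (hφK.trans hKsub)) hk₃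
  set V := MeasureTheory.volume.real K with hV
  set v := MeasureTheory.volume.real (Metric.ball (0 : EuclideanSpace ℝ (Fin d)) 1) with hv
  have hV0 : 0 ≤ V := MeasureTheory.measureReal_nonneg
  have hv0 : 0 < v := ENNReal.toReal_pos
    (Metric.measure_ball_pos _ _ one_pos).ne' MeasureTheory.measure_ball_lt_top.ne
  set Cη := V + C₃ * Real.exp D with hCη
  have hCη0 : 0 < Cη := by positivity
  set C₄ := (d + 1) * (C₂ * c₀ * Mp 1 * h 0) with hC₄
  have hC₄0 : 0 < C₄ := by
    have := hMpos 1
    have := hh.1 0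
    positivity
  set C₅ := 2 ^ (d + 2) * C₄ ^ d * (C₂ * c₀ * Cη) with hC₅
  have hC₅0 : 0 < C₅ := by positivity
  refine ⟨1 + C₅ / v, by positivity, min ε₂ ε₃,
    ⟨lt_min hε₂.1 hε₃.1, (min_le_left _ _).trans_lt hε₂.2⟩, fun ε hε0 hε x _ α => ?_⟩
  have hεI : ε ∈ Set.Ioo (0 : ℝ) 1 := ⟨hε0, (hε.trans_le (min_le_left _ _)).trans hε₂.2⟩
  have hu := hsmooth ε hεI
  have hcs : HasCompactSupport (f ε) :=
    hK.of_isClosed_subset (isClosed_tsupport _) (hsupp ε hεI)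
  have hb := hb ε hε0 (hε.trans_le (min_le_left _ _))
  have hL2 := hL2 ε hε0 (hε.trans_le (min_le_right _ _))
  have hD := hD (1 / ε) (one_div_pos.2 hε0)
  have hN₂ := assocN_nonneg (Mp := Mp) k₂ (1 / ε)
  set N := assocN Mp k (1 / ε)
  set N₂ := assocN Mp k₂ (1 / ε)
  set N₃ := assocN Mp k₃ (1 / ε)
  set δ := Real.exp (-((d + 2) * (N₂ + N))) with hδ
  have hδ0 : 0 < δ := Real.exp_pos _
  set X := Real.exp N₂ with hX
  have hX0 : 0 < X := Real.exp_pos _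
  have hη : ∫ x, ‖f ε x‖ ≤ Cη * δ := by
    refine (integral_norm_le_of_integral_norm_sq hu.continuous hK (hsupp ε hεI) hδ0).trans ?_
    have h1 : ∫ x, ‖f ε x‖ ^ 2 ≤ C₃ * Real.exp D * δ ^ 2 := by
      refine hL2.trans ?_
      rw [mul_assoc, hδ, ← Real.exp_nat_mul, ← Real.exp_add]
      refine mul_le_mul_of_nonneg_left (Real.exp_le_exp.2 ?_) hC₃.le
      push_cast at hD ⊢
      linarith
    have h2 : (∫ x, ‖f ε x‖ ^ 2) / δ ≤ C₃ * Real.exp D * δ := by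
      rw [div_le_iff₀ hδ0]
      linarith
    rw [hCη]
    linarith
  obtain ⟨l, hl, hα⟩ := exists_list_mderiv_eq α
  rw [hα, ← hl]
  have hY : 0 < C₂ * X := by positivity
  have hgg := integral_norm_sq_lderiv_le hH0 hM2' hh hu hcs hY hb l
  have hLip := norm_lderiv_sub_le hMpos hH0 hM2' hh hu hY hb l
  have hM1pos := hMpos 1
  have hh0 := hh.1 0
  have hQ : 0 < Mp l.length * ∏ i ∈ Finset.range l.length, h i :=
    mul_pos (hMpos _) (hh.prod_pos _)
  have hfin := pow_norm_le_of_lipschitz_of_integrable (by positivity) hLip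
    (integrable_norm_sq (hu.lderiv l).continuous
      (hcs.of_isClosed_subset (isClosed_tsupport _) (tsupport_lderiv_subset l _))) x
  set Q := Mp l.length * ∏ i ∈ Finset.range l.length, h i
  set g := lderiv l (f ε)
  rw [← hv] at hfin
  have hXδ : X ^ (d + 2) * δ = Real.exp (-N) ^ (d + 2) := by
    rw [hX, hδ, ← Real.exp_nat_mul, ← Real.exp_nat_mul, ← Real.exp_add]
    congr 1
    push_cast
    ring
  have hX1 : X ^ (d + 1) ≤ X ^ (d + 2) :=
    pow_le_pow_right₀ (Real.one_le_exp hN₂) (by omega)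
  have hmain : ‖g x‖ ^ (d + 2) * v ≤ C₅ * (Q * Real.exp (-N)) ^ (d + 2) := by
    calc ‖g x‖ ^ (d + 2) * v ≤ _ := hfin
      _ ≤ 2 ^ (d + 2) * ((d + 1) * (c₀ * Mp 1 * h 0 * (C₂ * X) * Q)) ^ d *
          (Cη * δ * (C₂ * X * c₀ * Q ^ 2)) :=
        mul_le_mul_of_nonneg_left
          (hgg.trans (mul_le_mul_of_nonneg_right hη (by positivity))) (by positivity)
      _ = C₅ * Q ^ (d + 2) * δ * X ^ (d + 1) := by
        have hC₄' : (d + 1) * (c₀ * Mp 1 * h 0 * (C₂ * X) * Q) = C₄ * X * Q := by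
          rw [hC₄]; ring
        rw [hC₅, hC₄', mul_pow, mul_pow]
        ring
      _ ≤ C₅ * Q ^ (d + 2) * δ * X ^ (d + 2) :=
        mul_le_mul_of_nonneg_left hX1 (by positivity)
      _ = C₅ * Q ^ (d + 2) * (X ^ (d + 2) * δ) := by ring
      _ = _ := by rw [hXδ]; ring
  rw [div_le_iff₀ hQ]
  have hQN : 0 < Q * Real.exp (-N) := by positivity
  have ht : (‖g x‖ / (Q * Real.exp (-N))) ^ (d + 2) ≤ C₅ / v := by
    rw [div_pow, div_le_div_iff₀ (by positivity) hv0]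
    exact hmain
  have ht' : ‖g x‖ / (Q * Real.exp (-N)) ≤ 1 + C₅ / v := by
    have hCv : 0 ≤ C₅ / v := by positivity
    rcases le_total (‖g x‖ / (Q * Real.exp (-N))) 1 with h1 | h1
    · linarith
    · have := le_self_pow₀ h1 (by omega : d + 2 ≠ 0)
      linarith
  rw [div_le_iff₀ hQN] at ht'
  linarith
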